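/- arXiv:2208.05328 — 2 statements merged into one kernel-verified Lean document; each statement's English description precedes it below -/
import Mathlib

section
/- Fix μ ∈ ℂ and λ ∈ ℂ with Re λ > 0. For every s in the open set 𝕃_λ, the inner compositions φ_n(s) := q_1(s, q_2(s, …, q_n(s, 0))) with q_j(s, z) := exp(μ z)/(1 + exp(λ(j − s))) converge as n → ∞; the convergence is uniform on every compact subset of 𝕃_λ, the limit function β_{λ,μ} is holomorphic on 𝕃_λ, and the limit is unchanged if the initial value 0 is replaced by any other z₀ ∈ ℂ. -/
open Filter Topology
open scoped ENNReal NNReal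

noncomputable section

/-- Inner composition `q 1 s (q 2 s (… (q n s z)))`, nested in the variable `z`
with the parameter `s` held fixed. -/
def innerComp (q : ℕ → ℂ → ℂ → ℂ) : ℕ → ℂ → ℂ → ℂ
  | 0, _, z => z
  | n + 1, s, z => innerComp q n s (q (n + 1) s z)

/-- The building blocks `q_j(s,z) = exp(μ z)/(1 + exp(λ (j - s)))`. -/
def qfun (lam mu : ℂ) (j : ℕ) (s z : ℂ) : ℂ :=
  Complex.exp (mu * z) / (1 + Complex.exp (lam * ((j : ℂ) - s)))

/-- The set `𝕃_λ = {s : λ(j - s) ≠ (2k+1)πi for all integers j ≥ 1, k}`. -/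
def Lset (lam : ℂ) : Set ℂ :=
  {s : ℂ | ∀ j : ℕ, 1 ≤ j → ∀ k : ℤ,
    lam * ((j : ℂ) - s) ≠ (2 * (k : ℂ) + 1) * (Real.pi : ℂ) * Complex.I}

/-- The function `β_{λ,μ}(s)`, defined as the limit (when it exists) of the inner
compositions `q_1(s, q_2(s, …, q_n(s, 0)))`. -/
def betaF (lam mu : ℂ) (s : ℂ) : ℂ :=
  limUnder atTop (fun n : ℕ => innerComp (qfun lam mu) n s 0)

/-- The denominators `1 + exp(λ (j - s))` vanish nowhere exactly on `𝕃_λ`. -/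
lemma mem_Lset_iff {lam s : ℂ} :
    s ∈ Lset lam ↔ ∀ j : ℕ, 1 ≤ j → 1 + Complex.exp (lam * ((j : ℂ) - s)) ≠ 0 := by
  refine forall₂_congr fun j _ => ?_
  have h : 1 + Complex.exp (lam * ((j : ℂ) - s)) = 0 ↔
      ∃ k : ℤ, lam * ((j : ℂ) - s) = (2 * (k : ℂ) + 1) * (Real.pi : ℂ) * Complex.I := by
    rw [add_comm, add_eq_zero_iff_eq_neg, ← Complex.exp_pi_mul_I,
      Complex.exp_eq_exp_iff_exists_int]
    refine exists_congr fun k => ?_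
    rw [show (Real.pi : ℂ) * Complex.I + k * (2 * Real.pi * Complex.I) =
      (2 * (k : ℂ) + 1) * (Real.pi : ℂ) * Complex.I by ring]
  rw [Ne, h, not_exists]

/-- The denominators tend to infinity, uniformly on bounded sets of parameters. -/
lemma exists_le_norm_denominator {lam : ℂ} (hlam : 0 < lam.re) {K : Set ℂ} (hK : IsCompact K)
    (A : ℝ) : ∃ N : ℕ, ∀ j ≥ N, ∀ s ∈ K, A ≤ ‖1 + Complex.exp (lam * ((j : ℂ) - s))‖ := by
  obtain ⟨B, hB⟩ := hK.exists_bound_of_continuousOn (f := fun s : ℂ => lam * s) (by fun_prop)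
  have hlim : Tendsto (fun j : ℕ => Real.exp (lam.re * j - B)) atTop atTop := by
    refine Real.tendsto_exp_atTop.comp (tendsto_atTop_add_const_right _ (-B) ?_)
    exact tendsto_natCast_atTop_atTop.const_mul_atTop hlam
  obtain ⟨N, hN⟩ := eventually_atTop.1 (hlim.eventually_ge_atTop (A + 1))
  refine ⟨N, fun j hj s hs => ?_⟩
  have hre : (lam * ((j : ℂ) - s)).re = lam.re * j - (lam * s).re := by
    rw [mul_sub, Complex.sub_re]; simp
  have hexp : Real.exp (lam.re * j - B) ≤ ‖Complex.exp (lam * ((j : ℂ) - s))‖ := by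
    rw [Complex.norm_exp, hre]
    have := (Complex.re_le_norm _).trans (hB s hs)
    gcongr
  have htri := norm_sub_le (1 + Complex.exp (lam * ((j : ℂ) - s))) 1
  rw [add_sub_cancel_left, norm_one] at htri
  linarith [hN j hj]

lemma isOpen_Lset {lam : ℂ} (hlam : 0 < lam.re) : IsOpen (Lset lam) := by
  rw [isOpen_iff_mem_nhds]
  intro s hs
  obtain ⟨N, hN⟩ := exists_le_norm_denominator hlam (isCompact_closedBall s 1) 1
  have hfin : ∀ᶠ t in 𝓝 s, ∀ j ∈ Set.Ico 1 N, 1 + Complex.exp (lam * ((j : ℂ) - t)) ≠ 0 := by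
    refine (eventually_all_finite (Set.finite_Ico 1 N)).2 fun j hj => ?_
    exact ContinuousAt.eventually_ne (by fun_prop) (mem_Lset_iff.1 hs j hj.1)
  filter_upwards [hfin, Metric.closedBall_mem_nhds s one_pos] with t ht htb
  refine mem_Lset_iff.2 fun j hj => ?_
  rcases lt_or_ge j N with hjN | hjN
  · exact ht j ⟨hj, hjN⟩
  · exact norm_pos_iff.1 (one_pos.trans_le (hN j hjN t htb))

lemma Complex.norm_exp_sub_exp_le {r : ℝ} {a b : ℂ} (ha : ‖a‖ ≤ r) (hb : ‖b‖ ≤ r) :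
    ‖Complex.exp a - Complex.exp b‖ ≤ Real.exp r * ‖a - b‖ := by
  refine (convex_closedBall (0 : ℂ) r).norm_image_sub_le_of_norm_hasDerivWithin_le
    (fun z _ => (Complex.hasDerivAt_exp z).hasDerivWithinAt) (fun z hz => ?_)
    (by simpa using hb) (by simpa using ha)
  rw [Complex.norm_exp]
  exact Real.exp_le_exp.2 ((Complex.re_le_norm z).trans (by simpa using hz))

lemma norm_qfun_le {lam mu s z : ℂ} {j : ℕ} {R : ℝ} (hz : ‖z‖ ≤ R) :
    ‖qfun lam mu j s z‖ ≤
      Real.exp (‖mu‖ * R) * ‖(1 + Complex.exp (lam * ((j : ℂ) - s)))⁻¹‖ := by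
  rw [qfun, div_eq_mul_inv, norm_mul, Complex.norm_exp]
  gcongr
  refine (Complex.re_le_norm _).trans ?_
  rw [norm_mul]
  gcongr

lemma norm_qfun_sub_le {lam mu s z w : ℂ} {j : ℕ} {R : ℝ} (hz : ‖z‖ ≤ R) (hw : ‖w‖ ≤ R) :
    ‖qfun lam mu j s z - qfun lam mu j s w‖ ≤
      Real.exp (‖mu‖ * R) * ‖mu‖ * ‖(1 + Complex.exp (lam * ((j : ℂ) - s)))⁻¹‖ * ‖z - w‖ := by
  have h := Complex.norm_exp_sub_exp_le (r := ‖mu‖ * R) (a := mu * z) (b := mu * w)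
    (by rw [norm_mul]; gcongr) (by rw [norm_mul]; gcongr)
  rw [← mul_sub, norm_mul] at h
  rw [qfun, qfun, ← sub_div, div_eq_mul_inv, norm_mul]
  calc _ ≤ Real.exp (‖mu‖ * R) * (‖mu‖ * ‖z - w‖) *
        ‖(1 + Complex.exp (lam * ((j : ℂ) - s)))⁻¹‖ := by gcongr
    _ = _ := by ring

lemma exists_norm_inv_denominator_le {lam : ℂ} {K : Set ℂ} (hKL : K ⊆ Lset lam)
    (hK : IsCompact K) {j : ℕ} (hj : 1 ≤ j) :
    ∃ M : ℝ, 0 ≤ M ∧ ∀ s ∈ K, ‖(1 + Complex.exp (lam * ((j : ℂ) - s)))⁻¹‖ ≤ M := by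
  obtain ⟨M, hM⟩ := hK.exists_bound_of_continuousOn
    (f := fun s : ℂ => (1 + Complex.exp (lam * ((j : ℂ) - s)))⁻¹)
    (ContinuousOn.inv₀ (by fun_prop) fun s hs => mem_Lset_iff.1 (hKL hs) j hj)
  exact ⟨max M 0, le_max_right _ _, fun s hs => (hM s hs).trans (le_max_left _ _)⟩

/-- Each finite composition is Lipschitz in `z` on bounded sets, uniformly for `s` in a
compact subset of `𝕃_λ`. -/
lemma exists_lipschitz_innerComp {lam : ℂ} (mu : ℂ) {K : Set ℂ} (hKL : K ⊆ Lset lam)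
    (hK : IsCompact K) (n : ℕ) (R : ℝ) :
    ∃ C : ℝ, 0 ≤ C ∧ ∀ s ∈ K, ∀ z w : ℂ, ‖z‖ ≤ R → ‖w‖ ≤ R →
      ‖innerComp (qfun lam mu) n s z - innerComp (qfun lam mu) n s w‖ ≤ C * ‖z - w‖ := by
  induction n generalizing R with
  | zero => exact ⟨1, zero_le_one, fun s _ z w _ _ => by simp [innerComp]⟩
  | succ n ih =>
    obtain ⟨M, hM0, hM⟩ := exists_norm_inv_denominator_le hKL hK (Nat.le_add_left 1 n)
    obtain ⟨C, hC0, hC⟩ := ih (Real.exp (‖mu‖ * R) * M)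
    refine ⟨C * (Real.exp (‖mu‖ * R) * ‖mu‖ * M), by positivity, fun s hs z w hz hw => ?_⟩
    have hq {u : ℂ} (hu : ‖u‖ ≤ R) :
        ‖qfun lam mu (n + 1) s u‖ ≤ Real.exp (‖mu‖ * R) * M :=
      (norm_qfun_le hu).trans (by gcongr; exact hM s hs)
    refine (hC s hs _ _ (hq hz) (hq hw)).trans ?_
    rw [mul_assoc C]
    refine mul_le_mul_of_nonneg_left ((norm_qfun_sub_le hz hw).trans ?_) hC0
    gcongr
    exact hM s hs

/-- For large `n` the `n`-fold composition contracts the ball of radius `R` at a geometric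
rate, and the next building block maps this ball to itself. -/
lemma exists_geometric_contraction {lam : ℂ} (mu : ℂ) (hlam : 0 < lam.re) {K : Set ℂ}
    (hKL : K ⊆ Lset lam) (hK : IsCompact K) {R : ℝ} (hR : 0 < R) :
    ∃ N : ℕ, ∃ C : ℝ, 0 ≤ C ∧ ∀ n ≥ N, ∀ s ∈ K, ∀ z w : ℂ, ‖z‖ ≤ R → ‖w‖ ≤ R →
      ‖qfun lam mu (n + 1) s z‖ ≤ R ∧
      ‖innerComp (qfun lam mu) n s z - innerComp (qfun lam mu) n s w‖ ≤
        C * (1 / 2) ^ n * ‖z - w‖ := by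
  set E := Real.exp (‖mu‖ * R)
  have hEpos : 0 < E := Real.exp_pos _
  obtain ⟨N, hN⟩ := exists_le_norm_denominator hlam hK (max (E / R) (2 * E * (‖mu‖ + 1)))
  have hinv (j : ℕ) (hj : j ≥ N) (s : ℂ) (hs : s ∈ K) :
      E * ‖(1 + Complex.exp (lam * ((j : ℂ) - s)))⁻¹‖ ≤ R ∧
      E * ‖mu‖ * ‖(1 + Complex.exp (lam * ((j : ℂ) - s)))⁻¹‖ ≤ 1 / 2 := by
    obtain ⟨h₁, h₂⟩ := max_le_iff.1 (hN j hj s hs)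
    have hpos : 0 < ‖1 + Complex.exp (lam * ((j : ℂ) - s))‖ :=
      (div_pos hEpos hR).trans_le h₁
    rw [norm_inv, ← div_eq_mul_inv, ← div_eq_mul_inv, div_le_iff₀ hpos, div_le_iff₀ hpos]
    rw [div_le_iff₀ hR] at h₁
    constructor <;> linarith
  have hmaps (j : ℕ) (hj : j ≥ N) (s : ℂ) (hs : s ∈ K) (z : ℂ) (hz : ‖z‖ ≤ R) :
      ‖qfun lam mu j s z‖ ≤ R := (norm_qfun_le hz).trans (hinv j hj s hs).1
  obtain ⟨C, hC0, hC⟩ := exists_lipschitz_innerComp mu hKL hK N R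
  refine ⟨N, C * 2 ^ N, by positivity, fun n hn s hs z w hz hw =>
    ⟨hmaps _ (Nat.le_succ_of_le hn) s hs z hz, ?_⟩⟩
  induction n, hn using Nat.le_induction generalizing z w with
  | base =>
    have h : C * 2 ^ N * (1 / 2) ^ N = C := by
      rw [mul_assoc, ← mul_pow]; norm_num
    rw [h]
    exact hC s hs z w hz hw
  | succ n hn ih =>
    have hn' : n + 1 ≥ N := Nat.le_succ_of_le hn
    refine (ih _ _ (hmaps _ hn' s hs z hz) (hmaps _ hn' s hs w hw)).trans ?_
    rw [pow_succ, ← mul_assoc, mul_assoc (C * 2 ^ N * (1 / 2) ^ n)]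
    gcongr
    exact (norm_qfun_sub_le hz hw).trans
      (mul_le_mul_of_nonneg_right (hinv _ hn' s hs).2 (norm_nonneg _))

/-- The inner compositions with initial value `0` converge to `betaF` at a geometric rate,
uniformly on compact subsets of `𝕃_λ`. -/
lemma exists_dist_innerComp_betaF_le {lam : ℂ} (mu : ℂ) (hlam : 0 < lam.re) {K : Set ℂ}
    (hKL : K ⊆ Lset lam) (hK : IsCompact K) :
    ∃ N : ℕ, ∃ C : ℝ, ∀ n ≥ N, ∀ s ∈ K,
      dist (innerComp (qfun lam mu) n s 0) (betaF lam mu s) ≤ C * (1 / 2) ^ n := by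
  obtain ⟨N, C, hC0, hC⟩ := exists_geometric_contraction mu hlam hKL hK one_pos
  refine ⟨N, 2 * C, fun n hn s hs => ?_⟩
  have hstep (m : ℕ) : dist (innerComp (qfun lam mu) (n + m) s 0)
      (innerComp (qfun lam mu) (n + (m + 1)) s 0) ≤ 2 * (C * (1 / 2) ^ n) / 2 / 2 ^ m := by
    have hnm : n + m ≥ N := hn.trans (Nat.le_add_right n m)
    have hq := (hC _ hnm s hs 0 0 (by simp) (by simp)).1
    have h := (hC _ hnm s hs 0 (qfun lam mu (n + m + 1) s 0) (by simp) hq).2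
    rw [zero_sub, norm_neg] at h
    rw [dist_eq_norm]
    calc _ ≤ C * (1 / 2) ^ (n + m) * ‖qfun lam mu (n + m + 1) s 0‖ := h
      _ ≤ C * (1 / 2) ^ (n + m) * 1 := by gcongr
      _ = _ := by rw [pow_add, one_div, inv_pow, inv_pow]; ring
  have hlim : Tendsto (fun m => innerComp (qfun lam mu) m s 0) atTop (𝓝 (betaF lam mu s)) := by
    obtain ⟨a, ha⟩ := cauchySeq_tendsto_of_complete (cauchySeq_of_le_geometric_two hstep)
    refine tendsto_nhds_limUnder ⟨a, (tendsto_add_atTop_iff_nat n).1 ?_⟩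
    simpa only [add_comm] using ha
  have hshift : Tendsto (fun m => innerComp (qfun lam mu) (n + m) s 0) atTop
      (𝓝 (betaF lam mu s)) := by
    simpa only [add_comm] using (tendsto_add_atTop_iff_nat n).2 hlim
  simpa [mul_assoc] using dist_le_of_le_geometric_two_of_tendsto₀ hstep hshift

lemma tendsto_const_mul_half_pow (C : ℝ) :
    Tendsto (fun n : ℕ => C * (1 / 2) ^ n) atTop (𝓝 0) := by
  simpa using (tendsto_pow_atTop_nhds_zero_of_lt_one (r := (1 / 2 : ℝ)) (by norm_num)
    (by norm_num)).const_mul C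

lemma tendstoUniformlyOn_innerComp {lam : ℂ} (mu : ℂ) (hlam : 0 < lam.re) {K : Set ℂ}
    (hKL : K ⊆ Lset lam) (hK : IsCompact K) :
    TendstoUniformlyOn (fun (n : ℕ) (s : ℂ) => innerComp (qfun lam mu) n s 0)
      (betaF lam mu) atTop K := by
  obtain ⟨N, C, hC⟩ := exists_dist_innerComp_betaF_le mu hlam hKL hK
  refine Metric.tendstoUniformlyOn_iff.2 fun ε hε => ?_
  filter_upwards [eventually_ge_atTop N,
    (tendsto_const_mul_half_pow C).eventually_lt_const hε] with n hn hlt s hs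
  rw [dist_comm]
  exact (hC n hn s hs).trans_lt hlt

lemma DifferentiableOn.innerComp_qfun {lam : ℂ} (mu : ℂ) (n : ℕ) {g : ℂ → ℂ}
    (hg : DifferentiableOn ℂ g (Lset lam)) :
    DifferentiableOn ℂ (fun s => innerComp (qfun lam mu) n s (g s)) (Lset lam) := by
  induction n generalizing g with
  | zero => exact hg
  | succ n ih =>
    refine ih (g := fun s => qfun lam mu (n + 1) s (g s)) ?_
    exact DifferentiableOn.div (by fun_prop) (by fun_prop)
      fun s hs => mem_Lset_iff.1 hs _ (Nat.le_add_left 1 n)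

/-- **The β Theorem (convergence).** For `Re λ > 0` the inner compositions defining
`β_{λ,μ}` converge uniformly on compact subsets of `𝕃_λ`, the limit is holomorphic on
`𝕃_λ`, and the limit does not depend on the initial value `z₀`. -/
theorem beta_convergence (lam mu : ℂ) (hlam : 0 < lam.re) :
    (∀ K : Set ℂ, K ⊆ Lset lam → IsCompact K →
      TendstoUniformlyOn (fun (n : ℕ) (s : ℂ) => innerComp (qfun lam mu) n s 0)
        (betaF lam mu) atTop K) ∧
    DifferentiableOn ℂ (betaF lam mu) (Lset lam) ∧
    (∀ s ∈ Lset lam, ∀ z₀ : ℂ,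
      Tendsto (fun n : ℕ => innerComp (qfun lam mu) n s z₀) atTop
        (𝓝 (betaF lam mu s))) := by
  refine ⟨fun K hKL hK => tendstoUniformlyOn_innerComp mu hlam hKL hK, ?_, fun s hs z₀ => ?_⟩
  · refine TendstoLocallyUniformlyOn.differentiableOn
      ((tendstoLocallyUniformlyOn_iff_forall_isCompact (isOpen_Lset hlam)).2
        fun K hKL hK => tendstoUniformlyOn_innerComp mu hlam hKL hK)
      (Eventually.of_forall fun n => ?_) (isOpen_Lset hlam)
    exact DifferentiableOn.innerComp_qfun mu n (differentiableOn_const 0)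
  · have hsub : {s} ⊆ Lset lam := Set.singleton_subset_iff.2 hs
    have hlim := (tendstoUniformlyOn_innerComp mu hlam hsub isCompact_singleton).tendsto_at
      (Set.mem_singleton s)
    obtain ⟨N, C, hC0, hC⟩ := exists_geometric_contraction mu hlam hsub isCompact_singleton
      (R := ‖z₀‖ + 1) (by positivity)
    have hdiff : Tendsto (fun n => innerComp (qfun lam mu) n s z₀ -
        innerComp (qfun lam mu) n s 0) atTop (𝓝 0) := by
      refine squeeze_zero_norm' ?_ (tendsto_const_mul_half_pow (C * ‖z₀‖))
      filter_upwards [eventually_ge_atTop N] with n hn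
      refine ((hC n hn s rfl z₀ 0 (by simp) (by rw [norm_zero]; positivity)).2).trans_eq ?_
      rw [sub_zero]
      ring
    simpa using hdiff.add hlim
end
end

section
/- Let μ ∈ ℂ with μ ≠ 0, let m ∈ ℕ, let s₀ ∈ ℂ, and let Q be a complex polynomial with Q(s₀) ≠ 0. Then there exists a complex polynomial P of degree ≤ m such that the function s ↦ exp(μ·P(s)) − Q(s) vanishes to order at least m+1 at s₀, i.e. its j-th derivative at s₀ equals 0 for every j = 0, 1, …, m. -/
open Filter Topology

noncomputable section

theorem Complex.exists_analytic_exp_sub_one_eq_mul :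
    ∃ h : ℂ → ℂ, (∀ z, AnalyticAt ℂ h z) ∧ h 0 = 1 ∧ ∀ z, Complex.exp z - 1 = z * h z := by
  refine ⟨dslope Complex.exp 0, fun z => ?_, by simp, fun z => ?_⟩
  · have hd : DifferentiableOn ℂ (dslope Complex.exp 0) Set.univ :=
      (Complex.differentiableOn_dslope univ_mem).2 Complex.differentiable_exp.differentiableOn
    exact hd.analyticAt univ_mem
  · simpa using (sub_smul_dslope Complex.exp 0 z).symm

theorem Polynomial.analyticAt_eval (P : Polynomial ℂ) (z : ℂ) :
    AnalyticAt ℂ (fun s => P.eval s) z :=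
  P.differentiable.analyticAt z

theorem analyticAt_exp_mul_eval_sub_eval (mu : ℂ) (P Q : Polynomial ℂ) (z : ℂ) :
    AnalyticAt ℂ (fun s : ℂ => Complex.exp (mu * P.eval s) - Q.eval s) z :=
  ((analyticAt_const.mul (P.analyticAt_eval z)).cexp).sub (Q.analyticAt_eval z)

/-- An approximate logarithm of `Q` at `s₀` can be corrected by a monomial in `s - s₀` so that the
order of contact increases by one. -/
theorem exists_le_analyticOrderAt_exp_mul_sub_succ {mu s₀ : ℂ} (hmu : mu ≠ 0) {n : ℕ}
    {P Q : Polynomial ℂ}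
    (hP : ((n + 1 : ℕ) : ℕ∞) ≤
      analyticOrderAt (fun s : ℂ => Complex.exp (mu * P.eval s) - Q.eval s) s₀) :
    ∃ c : ℂ, ((n + 1 + 1 : ℕ) : ℕ∞) ≤ analyticOrderAt (fun s : ℂ => Complex.exp
      (mu * (P + Polynomial.C c * (Polynomial.X - Polynomial.C s₀) ^ (n + 1)).eval s)
        - Q.eval s) s₀ := by
  obtain ⟨g, hg, hfg⟩ :=
    (natCast_le_analyticOrderAt (analyticAt_exp_mul_eval_sub_eval mu P Q s₀)).1 hP
  obtain ⟨h, hh, h0, hexp⟩ := Complex.exists_analytic_exp_sub_one_eq_mul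
  set c : ℂ := -g s₀ / (mu * Complex.exp (mu * P.eval s₀)) with hc
  have hpow : AnalyticAt ℂ (fun s : ℂ => mu * (c * (s - s₀) ^ (n + 1))) s₀ := by fun_prop
  set B : ℂ → ℂ := fun s =>
    Complex.exp (mu * P.eval s) * (mu * c) * h (mu * (c * (s - s₀) ^ (n + 1))) + g s with hB
  have hBa : AnalyticAt ℂ B s₀ :=
    ((((analyticAt_const.mul (P.analyticAt_eval s₀)).cexp).mul analyticAt_const).mul
      ((hh _).comp hpow)).add hg
  have hB0 : B s₀ = 0 := by
    have := Complex.exp_ne_zero (mu * P.eval s₀)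
    simp only [hB, sub_self, ne_eq, Nat.succ_ne_zero, not_false_eq_true, zero_pow, mul_zero, h0, hc]
    field_simp
    ring
  have hB1 : ((1 : ℕ) : ℕ∞) ≤ analyticOrderAt B s₀ := by
    rw [natCast_le_analyticOrderAt_iff_iteratedDeriv_eq_zero hBa]
    intro i hi
    obtain rfl : i = 0 := by omega
    simpa using hB0
  obtain ⟨k, hk, hBk⟩ := (natCast_le_analyticOrderAt hBa).1 hB1
  refine ⟨c, (natCast_le_analyticOrderAt (analyticAt_exp_mul_eval_sub_eval _ _ _ _)).2
    ⟨k, hk, ?_⟩⟩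
  filter_upwards [hfg, hBk] with s hs hsk
  have he := hexp (mu * (c * (s - s₀) ^ (n + 1)))
  simp only [hB, smul_eq_mul, pow_one] at hs hsk
  simp only [Polynomial.eval_add, Polynomial.eval_mul, Polynomial.eval_C, Polynomial.eval_pow,
    Polynomial.eval_sub, Polynomial.eval_X, mul_add, Complex.exp_add, smul_eq_mul]
  linear_combination hs + Complex.exp (mu * P.eval s) * he + (s - s₀) ^ (n + 1) * hsk

theorem exists_natDegree_le_and_le_analyticOrderAt_exp_mul_sub {mu : ℂ} (hmu : mu ≠ 0) (m : ℕ)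
    {s₀ : ℂ} {Q : Polynomial ℂ} (hQ : Q.eval s₀ ≠ 0) :
    ∃ P : Polynomial ℂ, P.natDegree ≤ m ∧ ((m + 1 : ℕ) : ℕ∞) ≤
      analyticOrderAt (fun s : ℂ => Complex.exp (mu * P.eval s) - Q.eval s) s₀ := by
  induction m with
  | zero =>
    refine ⟨Polynomial.C (Complex.log (Q.eval s₀) / mu), by simp, ?_⟩
    rw [natCast_le_analyticOrderAt_iff_iteratedDeriv_eq_zero
      (analyticAt_exp_mul_eval_sub_eval _ _ _ _)]
    intro i hi
    obtain rfl : i = 0 := by omega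
    simp [mul_div_cancel₀ _ hmu, Complex.exp_log hQ]
  | succ n ih =>
    obtain ⟨P, hPd, hP⟩ := ih
    obtain ⟨c, hc⟩ := exists_le_analyticOrderAt_exp_mul_sub_succ hmu hP
    refine ⟨_, ?_, hc⟩
    refine Polynomial.natDegree_add_le_of_degree_le (hPd.trans n.le_succ) ?_
    refine (Polynomial.natDegree_C_mul_le _ _).trans ?_
    simp

/-- **Existence of the mock Taylor polynomial.** Given `μ ≠ 0`, `m`, `s₀`, and a
polynomial `Q` with `Q(s₀) ≠ 0`, there is a polynomial `P` of degree `≤ m` such that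
`exp(μ·P(s)) − Q(s)` vanishes to order at least `m+1` at `s₀`. -/
theorem mock_taylor_polynomial (mu : ℂ) (hmu : mu ≠ 0) (m : ℕ) (s₀ : ℂ)
    (Q : Polynomial ℂ) (hQ : Q.eval s₀ ≠ 0) :
    ∃ P : Polynomial ℂ, P.natDegree ≤ m ∧ ∀ j : ℕ, j ≤ m →
      iteratedDeriv j (fun s : ℂ => Complex.exp (mu * P.eval s) - Q.eval s) s₀ = 0 := by
  obtain ⟨P, hPd, hP⟩ := exists_natDegree_le_and_le_analyticOrderAt_exp_mul_sub hmu m hQ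
  exact ⟨P, hPd, fun j hj => (natCast_le_analyticOrderAt_iff_iteratedDeriv_eq_zero
    (analyticAt_exp_mul_eval_sub_eval mu P Q s₀)).1 hP j (Nat.lt_succ_of_le hj)⟩
end
end
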